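/- Let m ≥ 1 be an integer and α₁, α₂ ∈ ℂ. Every entire function ψ, not identically zero, satisfying ψ(z + 2ω_s) = exp(2mη_s·z + α_s)·ψ(z) for s = 1, 2 and all z (i.e. every nonzero theta function of order m with characteristics) is of the form ψ(z) = C·e^{kz}·Π_{i=1}^{m} σ(z + t_i) for some constants C ≠ 0 and k, t₁, …, t_m ∈ ℂ. -/

import Mathlib

open Filter Topology

/-- The real determinant of two complex numbers that are linearly independent over `ℝ`. -/
theorem Complex.det_ne_zero_of_linearIndependent {p q : ℂ}
    (h : LinearIndependent ℝ ![p, q]) : p.re * q.im - p.im * q.re ≠ 0 := by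
  intro hD
  rw [LinearIndependent.pair_iff] at h
  have h1 := h q.re (-p.re) (by
    apply Complex.ext <;> simp <;> linarith)
  have h2 := h q.im (-p.im) (by
    apply Complex.ext <;> simp <;> linarith)
  have hp : p = 0 := Complex.ext (by simpa using h1.2) (by simpa using h2.2)
  simpa using (h 1 0 (by simp [hp])).1

/-- An entire function whose absolute value is doubly periodic is constant. -/
theorem Differentiable.apply_eq_of_norm_doublyPeriodic {p q : ℂ}
    (hD : p.re * q.im - p.im * q.re ≠ 0) {f : ℂ → ℂ} (hf : Differentiable ℂ f)
    (hp : ∀ z, ‖f (z + p)‖ = ‖f z‖) (hq : ∀ z, ‖f (z + q)‖ = ‖f z‖) (z w : ℂ) :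
    f z = f w := by
  apply hf.apply_eq_apply_of_bounded
  have hK : IsCompact ((fun x : ℝ × ℝ => (x.1 : ℂ) * p + x.2 * q) ''
      (Set.Icc 0 1 ×ˢ Set.Icc 0 1)) :=
    (isCompact_Icc.prod isCompact_Icc).image (by fun_prop)
  obtain ⟨M, hM⟩ := hK.exists_bound_of_continuousOn hf.continuous.continuousOn
  rw [isBounded_iff_forall_norm_le]
  refine ⟨M, ?_⟩
  rintro _ ⟨z, rfl⟩
  have hpp : Function.Periodic (fun z => ‖f z‖) p := hp
  have hqq : Function.Periodic (fun z => ‖f z‖) q := hq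
  set D := p.re * q.im - p.im * q.re with hDdef
  set x : ℝ := (z.re * q.im - z.im * q.re) / D with hx
  set y : ℝ := (p.re * z.im - p.im * z.re) / D with hy
  have hz : z = x * p + y * q := by
    apply Complex.ext <;>
      simp only [Complex.add_re, Complex.add_im, Complex.re_ofReal_mul, Complex.im_ofReal_mul,
        hx, hy] <;> field_simp <;> rw [hDdef] <;> ring
  have key : z = (Int.fract x : ℝ) * p + (Int.fract y : ℝ) * q
      + (⌊x⌋ : ℂ) * p + (⌊y⌋ : ℂ) * q := by
    conv_lhs => rw [hz, ← Int.fract_add_floor x, ← Int.fract_add_floor y]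
    push_cast
    ring
  have h1 := hqq.int_mul ⌊y⌋ ((Int.fract x : ℝ) * p + (Int.fract y : ℝ) * q + (⌊x⌋ : ℂ) * p)
  have h2 := hpp.int_mul ⌊x⌋ ((Int.fract x : ℝ) * p + (Int.fract y : ℝ) * q)
  rw [key, h1, h2]
  exact hM _ ⟨(Int.fract x, Int.fract y),
    ⟨⟨Int.fract_nonneg x, (Int.fract_lt_one x).le⟩,
      ⟨Int.fract_nonneg y, (Int.fract_lt_one y).le⟩⟩, rfl⟩

/-- An entire function is divisible by an entire function with simple zeros as soon as it
vanishes at these zeros. -/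
theorem exists_eq_mul_of_simple_zeros {f s : ℂ → ℂ} (hf : Differentiable ℂ f)
    (hs : Differentiable ℂ s) (hsimple : ∀ z, s z = 0 → deriv s z ≠ 0)
    (hfs : ∀ z, s z = 0 → f z = 0) :
    ∃ g : ℂ → ℂ, Differentiable ℂ g ∧ ∀ z, f z = s z * g z := by
  classical
  refine ⟨fun z => if s z = 0 then deriv f z / deriv s z else f z / s z, fun p => ?_,
    fun z => ?_⟩
  · have hdslope : ∀ {u : ℂ → ℂ}, Differentiable ℂ u → DifferentiableAt ℂ (dslope u p) p :=
      fun hu => ((Complex.differentiableOn_dslope Filter.univ_mem).2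
        hu.differentiableOn).differentiableAt Filter.univ_mem
    by_cases hp : s p = 0
    · have hne : dslope s p p ≠ 0 := by simpa using hsimple p hp
      refine ((hdslope hf).div (hdslope hs) hne).congr_of_eventuallyEq ?_
      filter_upwards [(hdslope hs).continuousAt.eventually_ne hne] with z hz
      by_cases hzp : z = p
      · subst hzp
        simp [hp]
      · have hz0 : s z ≠ 0 := by
          intro h0
          apply hz
          rw [dslope_of_ne _ hzp, slope_def_field, h0, hp]
          simp
        have hzp' : z - p ≠ 0 := sub_ne_zero.2 hzp
        simp only [Pi.div_apply, dslope_of_ne _ hzp, slope_def_field, hp, hfs p hp, hz0,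
          if_false, sub_zero]
        field_simp
    · refine ((hf p).div (hs p) hp).congr_of_eventuallyEq ?_
      filter_upwards [(hs p).continuousAt.eventually_ne hp] with z hz
      simp [hz]
  · by_cases hz : s z = 0
    · simp [hz, hfs z hz]
    · simp only [hz, if_false]
      field_simp

/-- Cancellation of a function with simple zeros from an identity of continuous functions. -/
theorem Continuous.eq_of_mul_eq_mul_of_simple_zeros {s f g : ℂ → ℂ}
    (hs : Differentiable ℂ s) (hsimple : ∀ z, s z = 0 → deriv s z ≠ 0)
    (hf : Continuous f) (hg : Continuous g) (h : ∀ z, s z * f z = s z * g z) (z : ℂ) :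
    f z = g z := by
  by_cases hz : s z = 0
  · have hev : ∀ᶠ w in 𝓝[≠] z, s w ≠ 0 := (hs z).hasDerivAt.eventually_ne (hsimple z hz)
    refine tendsto_nhds_unique (hf.continuousAt.tendsto.mono_left nhdsWithin_le_nhds)
      ((hg.continuousAt.tendsto.mono_left nhdsWithin_le_nhds).congr' (f₁ := g) (l₁ := 𝓝[≠] z) ?_)
    filter_upwards [hev] with w hw
    exact (mul_left_cancel₀ hw (h w)).symm
  · exact mul_left_cancel₀ hz (h z)

/-- A nonzero entire function with constant multipliers along a lattice is an exponential. -/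
theorem Differentiable.eq_const_mul_exp_of_multipliers {p q : ℂ}
    (hD : p.re * q.im - p.im * q.re ≠ 0) {f : ℂ → ℂ} (hf : Differentiable ℂ f) {a b : ℂ}
    (hp : ∀ z, f (z + p) = Complex.exp a * f z) (hq : ∀ z, f (z + q) = Complex.exp b * f z) :
    ∃ C k : ℂ, ∀ z, f z = C * Complex.exp (k * z) := by
  set D := p.re * q.im - p.im * q.re with hDdef
  obtain ⟨k, hkp, hkq⟩ : ∃ k : ℂ, (k * p).re = a.re ∧ (k * q).re = b.re := by
    refine ⟨⟨(a.re * q.im - b.re * p.im) / D, (a.re * q.re - b.re * p.re) / D⟩, ?_, ?_⟩ <;>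
      simp only [Complex.mul_re] <;> field_simp <;> rw [hDdef] <;> ring
  have hmult : ∀ {r c : ℂ}, (∀ z, f (z + r) = Complex.exp c * f z) → (k * r).re = c.re →
      ∀ z, ‖f (z + r) * Complex.exp (-(k * (z + r)))‖ = ‖f z * Complex.exp (-(k * z))‖ := by
    intro r c hr hk z
    rw [hr, norm_mul, norm_mul, norm_mul, Complex.norm_exp, Complex.norm_exp, Complex.norm_exp,
      mul_add, neg_add, Complex.add_re, Complex.neg_re (k * r), hk, Real.exp_add, Real.exp_neg c.re]
    have := (Real.exp_pos c.re).ne'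
    field_simp
  refine ⟨f 0, k, fun z => ?_⟩
  have hconst := Differentiable.apply_eq_of_norm_doublyPeriodic hD
    (f := fun z => f z * Complex.exp (-(k * z))) (by fun_prop) (hmult hp hkp) (hmult hq hkq) z 0
  simp only [mul_zero, neg_zero, Complex.exp_zero, mul_one] at hconst
  rw [← hconst, mul_assoc, ← Complex.exp_add]
  simp

/-- If a nowhere vanishing entire function is multiplied by `exp (c z + a)` and `exp (d z + b)`
along two independent periods `p` and `q`, then `c` and `d` are proportional to `p` and `q`. -/
theorem mul_eq_mul_of_theta_of_ne_zero {p q : ℂ}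
    (hD : p.re * q.im - p.im * q.re ≠ 0) {f : ℂ → ℂ} (hf : Differentiable ℂ f)
    (hne : ∀ z, f z ≠ 0) {c d a b : ℂ}
    (hp : ∀ z, f (z + p) = Complex.exp (c * z + a) * f z)
    (hq : ∀ z, f (z + q) = Complex.exp (d * z + b) * f z) : c * q = d * p := by
  have hf' : Differentiable ℂ (deriv f) := hf.deriv
  set h : ℂ → ℂ := fun z => deriv f z / f z with hh
  have hdiff : Differentiable ℂ h := hf'.div hf hne
  have hshift : ∀ {r e u : ℂ}, (∀ z, f (z + r) = Complex.exp (e * z + u) * f z) →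
      ∀ z, h (z + r) = h z + e := by
    intro r e u hr z
    have h1 : HasDerivAt (fun z => f (z + r)) (deriv f (z + r)) z :=
      (hf (z + r)).hasDerivAt.comp_add_const z r
    have h2 : HasDerivAt (fun z => Complex.exp (e * z + u) * f z)
        (Complex.exp (e * z + u) * (e * 1) * f z + Complex.exp (e * z + u) * deriv f z) z :=
      ((((hasDerivAt_id z).const_mul e).add_const u).cexp).mul (hf z).hasDerivAt
    have h3 := h1.unique (h2.congr_of_eventuallyEq (Eventually.of_forall hr))
    have hz := hne z
    have he := Complex.exp_ne_zero (e * z + u)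
    simp only [hh]
    rw [h3, hr]
    field_simp
    ring
  have hderiv : ∀ {r e : ℂ}, (∀ z, h (z + r) = h z + e) → ∀ z, deriv h (z + r) = deriv h z := by
    intro r e hr z
    rw [← deriv_comp_add_const, funext hr, deriv_add_const]
  have hconst : ∀ z, deriv h z = deriv h 0 := fun z =>
    Differentiable.apply_eq_of_norm_doublyPeriodic hD hdiff.deriv
      (fun z => by rw [hderiv (hshift hp)]) (fun z => by rw [hderiv (hshift hq)]) z 0
  have hlin : ∀ z, h z = h 0 + deriv h 0 * z := by
    intro z
    have hd : ∀ w, HasDerivAt (fun z => h z - deriv h 0 * z) (deriv h w - deriv h 0 * 1) w :=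
      fun w => (hdiff w).hasDerivAt.sub ((hasDerivAt_id w).const_mul _)
    have := is_const_of_deriv_eq_zero (fun w => (hd w).differentiableAt)
      (fun w => by rw [(hd w).deriv, hconst w]; ring) z 0
    simp only [mul_zero, sub_zero] at this
    rw [← this]
    ring
  have hc := hshift hp 0
  have hd := hshift hq 0
  rw [hlin (0 + p)] at hc
  rw [hlin (0 + q)] at hd
  linear_combination q * (-hc) + p * hd

/-- Factorization of an entire function with theta-like multipliers of order `m` in terms of an
entire function `σ` with the quasi-periodicity and the zeros of the Weierstrass sigma function. -/
theorem exists_theta_factorization {ω1 ω2 η1 η2 : ℂ}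
    (hind : LinearIndependent ℝ ![ω1, ω2]) (hleg : η1 * ω2 ≠ η2 * ω1)
    {σ : ℂ → ℂ} (hσdiff : Differentiable ℂ σ)
    (hσzero : ∀ z, σ z = 0 ↔ ∃ n1 n2 : ℤ, z = 2 * ((n1 : ℂ) * ω1 + (n2 : ℂ) * ω2))
    (hσsimple : ∀ z, σ z = 0 → deriv σ z ≠ 0)
    (hσ1 : ∀ z, σ (z + 2 * ω1) = -σ z * Complex.exp (2 * η1 * (z + ω1)))
    (hσ2 : ∀ z, σ (z + 2 * ω2) = -σ z * Complex.exp (2 * η2 * (z + ω2)))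
    (m : ℕ) {α1 α2 : ℂ} {ψ : ℂ → ℂ} (hψdiff : Differentiable ℂ ψ)
    (hψ1 : ∀ z, ψ (z + 2 * ω1) = Complex.exp (2 * (m : ℂ) * η1 * z + α1) * ψ z)
    (hψ2 : ∀ z, ψ (z + 2 * ω2) = Complex.exp (2 * (m : ℂ) * η2 * z + α2) * ψ z) :
    ∃ (C k : ℂ) (t : Fin m → ℂ),
      ∀ z : ℂ, ψ z = C * Complex.exp (k * z) * ∏ i : Fin m, σ (z + t i) := by
  have hD : (2 * ω1).re * (2 * ω2).im - (2 * ω1).im * (2 * ω2).re ≠ 0 := by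
    have h := Complex.det_ne_zero_of_linearIndependent hind
    contrapose! h
    simp at h
    linarith
  induction m generalizing α1 α2 ψ with
  | zero =>
    obtain ⟨C, k, h⟩ := hψdiff.eq_const_mul_exp_of_multipliers hD (a := α1) (b := α2)
      (by simpa using hψ1) (by simpa using hψ2)
    exact ⟨C, k, Fin.elim0, by simpa using h⟩
  | succ m ih =>
    obtain ⟨a, ha⟩ : ∃ a, ψ a = 0 := by
      by_contra! hne
      have h := mul_eq_mul_of_theta_of_ne_zero hD hψdiff hne hψ1 hψ2
      have hm : (m : ℂ) + 1 ≠ 0 := Nat.cast_add_one_ne_zero m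
      apply hleg
      apply mul_left_cancel₀ hm
      push_cast at h
      linear_combination h / 4
    have hzeros : ∀ {r e u : ℂ}, (∀ z, ψ (z + r) = Complex.exp (e * z + u) * ψ z) →
        Function.Periodic (fun z => ψ z = 0) r := by
      intro r e u hr z
      simp [hr, Complex.exp_ne_zero]
    set s : ℂ → ℂ := fun z => σ (z + -a) with hs
    have hsdiff : Differentiable ℂ s := by fun_prop
    have hssimple : ∀ z, s z = 0 → deriv s z ≠ 0 := by
      intro z hz
      rw [hs, deriv_comp_add_const]
      exact hσsimple _ hz
    obtain ⟨φ, hφdiff, hφ⟩ := exists_eq_mul_of_simple_zeros hψdiff hsdiff hssimple (by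
      intro z hz
      obtain ⟨n1, n2, h⟩ := (hσzero _).1 hz
      have hz' : z = a + n1 * (2 * ω1) + n2 * (2 * ω2) := by linear_combination h
      have h1 := (hzeros hψ1).int_mul n1 a
      have h2 := (hzeros hψ2).int_mul n2 (a + n1 * (2 * ω1))
      rw [hz', h2, h1]
      exact ha)
    have hquasi : ∀ {w e u : ℂ},
        (∀ z, σ (z + 2 * w) = -σ z * Complex.exp (2 * e * (z + w))) →
        (∀ z, ψ (z + 2 * w) = Complex.exp (2 * ((m + 1 : ℕ) : ℂ) * e * z + u) * ψ z) →
        ∀ z, φ (z + 2 * w) =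
          Complex.exp (2 * (m : ℂ) * e * z + (u - 2 * e * (w - a) - Real.pi * Complex.I)) * φ z := by
      intro w e u hσw hψw
      refine Continuous.eq_of_mul_eq_mul_of_simple_zeros hsdiff hssimple
        (hφdiff.continuous.comp (by fun_prop))
        ((by fun_prop : Continuous _).mul hφdiff.continuous) fun z => ?_
      have h := hψw z
      have hσz := hσw (z + -a)
      have hsz : s (z + 2 * w) = -s z * Complex.exp (2 * e * (z + -a + w)) := by
        rw [← hσz, hs]
        ring_nf
      rw [hφ, hφ, hsz] at h
      have hexp : Complex.exp (2 * ((m + 1 : ℕ) : ℂ) * e * z + u) =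
          -(Complex.exp (2 * (m : ℂ) * e * z + (u - 2 * e * (w - a) - Real.pi * Complex.I)) *
            Complex.exp (2 * e * (z + -a + w))) := by
        rw [← Complex.exp_add, ← Complex.exp_add_pi_mul_I]
        congr 1
        push_cast
        ring
      rw [hexp] at h
      apply mul_left_cancel₀ (Complex.exp_ne_zero (2 * e * (z + -a + w)))
      linear_combination -h
    obtain ⟨C, k, t, ht⟩ := ih hφdiff (hquasi hσ1 hψ1) (hquasi hσ2 hψ2)
    refine ⟨C, k, Fin.cons (-a) t, fun z => ?_⟩
    rw [hφ, ht, Fin.prod_univ_succ]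
    simp only [Fin.cons_zero, Fin.cons_succ, hs]
    ring

/-- **Factorization of theta functions of order `m`.** Every nonzero entire function
satisfying `ψ(z + 2ω_s) = exp(2mη_s z + α_s) ψ(z)` for `s = 1, 2` is of the form
`ψ(z) = C e^{kz} ∏_{i=1}^m σ(z + tᵢ)` for some constants `C ≠ 0`, `k`, `t₁, …, t_m`. -/
theorem theta_function_factorization
    -- the period lattice
    (ω1 ω2 : ℂ) (hind : LinearIndependent ℝ ![ω1, ω2])
    (η1 η2 : ℂ) (hleg : η1 * ω2 - η2 * ω1 = (Real.pi : ℂ) * Complex.I / 2)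
    (ω : Fin 4 → ℂ) (hω : ω = ![0, ω1, ω2, -ω1 - ω2])
    (η : Fin 4 → ℂ) (hη : η = ![0, η1, η2, -η1 - η2])
    -- the Weierstrass sigma function
    (σ : ℂ → ℂ) (hσdiff : Differentiable ℂ σ)
    (hσodd : ∀ z, σ (-z) = -σ z)
    (hσzero : ∀ z, σ z = 0 ↔ ∃ n1 n2 : ℤ, z = 2 * ((n1 : ℂ) * ω1 + (n2 : ℂ) * ω2))
    (hσsimple : ∀ z, σ z = 0 → deriv σ z ≠ 0)
    (hσnorm : deriv σ 0 = 1)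
    (hσper : ∀ s : Fin 4, s = 1 ∨ s = 2 → ∀ z,
      σ (z + 2 * ω s) = -σ z * Complex.exp (2 * η s * (z + ω s)))
    -- a nonzero theta function of order m with characteristics
    (m : ℕ) (hm : 1 ≤ m) (α1 α2 : ℂ)
    (ψ : ℂ → ℂ) (hψdiff : Differentiable ℂ ψ) (hψ0 : ψ ≠ 0)
    (hψ1 : ∀ z, ψ (z + 2 * ω1) = Complex.exp (2 * (m : ℂ) * η1 * z + α1) * ψ z)
    (hψ2 : ∀ z, ψ (z + 2 * ω2) = Complex.exp (2 * (m : ℂ) * η2 * z + α2) * ψ z) :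
    ∃ (C k : ℂ) (t : Fin m → ℂ), C ≠ 0 ∧
      ∀ z : ℂ, ψ z = C * Complex.exp (k * z) * ∏ i : Fin m, σ (z + t i) := by
  subst hω hη
  have hleg' : η1 * ω2 ≠ η2 * ω1 := by
    rw [← sub_ne_zero, hleg]
    simp [Real.pi_ne_zero]
  obtain ⟨C, k, t, h⟩ := exists_theta_factorization hind hleg' hσdiff hσzero hσsimple
    (by simpa using hσper 1 (.inl rfl)) (by simpa using hσper 2 (.inr rfl)) m hψdiff hψ1 hψ2
  refine ⟨C, k, t, ?_, h⟩
  rintro rfl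
  exact hψ0 (funext fun z => by simpa using h z)
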